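/- arXiv:2007.13274 — 5 statements merged into one kernel-verified Lean document; each statement's English description precedes it below -/
import Mathlib

section
/- Let F be a 5×5 real matrix indexed by {0,1,2,3,4} with zero diagonal. Let σ be the permutation fixing 0 and sending 1↦2, 2↦3, 3↦4, 4↦1, and let τ be the permutation fixing 0 and swapping 1↔4 and 2↔3. Suppose F satisfies the colored constraint F_{σ(i), σ(j)} = F_{j,i} for all i, j, and the uncolored constraint F_{τ(i), τ(j)} = F_{i,j} for all i, j. Then F = Fᵀ, and moreover: F_{0,j} = F_{j,0} = F_{0,1} for all j ∈ {1,2,3,4}; F_{1,2} = F_{2,1} = F_{1,4} = F_{4,1} = F_{2,3} = F_{3,2} = F_{3,4} = F_{4,3}; and F_{1,3} = F_{3,1} = F_{2,4} = F_{4,2}. -/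
open Matrix

theorem alternating_field_square_constraints (F : Matrix (Fin 5) (Fin 5) ℝ)
    (hdiag : ∀ i, F i i = 0)
    (σ : Equiv.Perm (Fin 5))
    (hσ0 : σ 0 = 0) (hσ1 : σ 1 = 2) (hσ2 : σ 2 = 3) (hσ3 : σ 3 = 4) (hσ4 : σ 4 = 1)
    (τ : Equiv.Perm (Fin 5))
    (hτ0 : τ 0 = 0) (hτ1 : τ 1 = 4) (hτ2 : τ 2 = 3) (hτ3 : τ 3 = 2) (hτ4 : τ 4 = 1)
    (hcolored : ∀ i j, F (σ i) (σ j) = F j i)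
    (huncolored : ∀ i j, F (τ i) (τ j) = F i j) :
    F = Fᵀ ∧
    (∀ j : Fin 5, j ≠ 0 → F 0 j = F j 0 ∧ F 0 j = F 0 1) ∧
    (F 1 2 = F 2 1 ∧ F 1 2 = F 1 4 ∧ F 1 2 = F 4 1 ∧ F 1 2 = F 2 3 ∧
      F 1 2 = F 3 2 ∧ F 1 2 = F 3 4 ∧ F 1 2 = F 4 3) ∧
    (F 1 3 = F 3 1 ∧ F 1 3 = F 2 4 ∧ F 1 3 = F 4 2) := by
  simp only [Fin.forall_fin_succ, IsEmpty.forall_iff, and_true,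
    Fin.succ_zero_eq_one, Fin.reduceSucc, hσ0, hσ1, hσ2, hσ3, hσ4] at hcolored
  simp only [Fin.forall_fin_succ, IsEmpty.forall_iff, and_true,
    Fin.succ_zero_eq_one, Fin.reduceSucc, hτ0, hτ1, hτ2, hτ3, hτ4] at huncolored
  obtain ⟨c0, c1, c2, c3, c4⟩ := hcolored
  obtain ⟨u0, u1, u2, u3, u4⟩ := huncolored
  refine ⟨?_, ?_, ?_, ?_⟩
  · ext i j
    fin_cases i <;> fin_cases j <;> simp only [Matrix.transpose_apply, Fin.reduceFinMk,
      Fin.zero_eta, Fin.mk_one, Fin.isValue] <;> grind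
  · intro j hj
    fin_cases j <;> simp only [Fin.reduceFinMk, Fin.zero_eta, Fin.mk_one, Fin.isValue] at hj ⊢ <;>
      grind
  · grind
  · grind
end

section
/- Let F be a 5×5 real matrix indexed by {0,1,2,3,4} with zero diagonal. Let σ be the permutation fixing 0 and sending 1↦2, 2↦3, 3↦4, 4↦1, and let τ be the permutation fixing 0 and swapping 1↔4 and 2↔3. Suppose F satisfies F_{σ(i), σ(j)} = F_{i,j} for all i, j, and F_{τ(i), τ(j)} = F_{j,i} for all i, j. Then for every index i, the i-th row sum of F equals the i-th column sum of F, i.e. (F - Fᵀ) ⬝ 1 = 0 where 1 is the all-ones vector. -/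
open Matrix

theorem row_sum_comp_eq_of_uncolored {ι R : Type*} [Fintype ι] [AddCommMonoid R]
    {F : Matrix ι ι R} {σ : Equiv.Perm ι} (h : ∀ i j, F (σ i) (σ j) = F i j) (i : ι) :
    ∑ j, F (σ i) j = ∑ j, F i j := by
  rw [← Equiv.sum_comp σ]
  simp only [h]

theorem row_sum_comp_eq_col_sum_of_colored {ι R : Type*} [Fintype ι] [AddCommMonoid R]
    {F : Matrix ι ι R} {τ : Equiv.Perm ι} (h : ∀ i j, F (τ i) (τ j) = F j i) (i : ι) :
    ∑ j, F (τ i) j = ∑ j, F j i := by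
  rw [← Equiv.sum_comp τ]
  simp only [h]

theorem second_law_no_new_constraints (F : Matrix (Fin 5) (Fin 5) ℝ)
    (hdiag : ∀ i, F i i = 0)
    (σ : Equiv.Perm (Fin 5))
    (hσ0 : σ 0 = 0) (hσ1 : σ 1 = 2) (hσ2 : σ 2 = 3) (hσ3 : σ 3 = 4) (hσ4 : σ 4 = 1)
    (τ : Equiv.Perm (Fin 5))
    (hτ0 : τ 0 = 0) (hτ1 : τ 1 = 4) (hτ2 : τ 2 = 3) (hτ3 : τ 3 = 2) (hτ4 : τ 4 = 1)
    (huncolored : ∀ i j, F (σ i) (σ j) = F i j)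
    (hcolored : ∀ i j, F (τ i) (τ j) = F j i) :
    (∀ i, ∑ j, F i j = ∑ j, F j i) ∧ (F - Fᵀ) *ᵥ (fun _ => (1 : ℝ)) = 0 := by
  have hrow := row_sum_comp_eq_of_uncolored huncolored
  have h12 := hrow 1
  have h23 := hrow 2
  have h34 := hrow 3
  rw [hσ1] at h12
  rw [hσ2] at h23
  rw [hσ3] at h34
  have hsum : ∀ i, ∑ j, F i j = ∑ j, F j i := by
    intro i
    rw [← row_sum_comp_eq_col_sum_of_colored hcolored i]
    fin_cases i
    · exact congrArg (fun k => ∑ j, F k j) hτ0.symm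
    · exact (h34.trans (h23.trans h12)).symm.trans (congrArg (fun k => ∑ j, F k j) hτ1.symm)
    · exact h23.symm.trans (congrArg (fun k => ∑ j, F k j) hτ2.symm)
    · exact h23.trans (congrArg (fun k => ∑ j, F k j) hτ3.symm)
    · exact (h34.trans (h23.trans h12)).trans (congrArg (fun k => ∑ j, F k j) hτ4.symm)
  refine ⟨hsum, funext fun i => ?_⟩
  simp [mulVec, dotProduct, Finset.sum_sub_distrib, hsum i]
end

section
/- Let A, B, C be n×n complex matrices such that 1 - C*A, 1 - B*C, and 1 - B*((1+A)*(1-C*A)⁻¹*(1+C) - 1) and 1 - ((1+C)*(1-B*C)⁻¹*(1+B) - 1)*A are all invertible (1 denoting the identity matrix). Then (1 - C*A)⁻¹ * (1 + C) * (1 - B*((1+A)*(1-C*A)⁻¹*(1+C) - 1))⁻¹ = (1 - ((1+C)*(1-B*C)⁻¹*(1+B) - 1)*A)⁻¹ * (1 + C) * (1 - B*C)⁻¹. -/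
open Matrix

theorem resolvent_intertwining {R : Type*} [Ring R] {A B C P Q : R}
    (hP : (1 - C * A) * P = 1) (hQ : Q * (1 - B * C) = 1) :
    (1 - ((1 + C) * Q * (1 + B) - 1) * A) * (P * (1 + C)) =
      (1 + C) * Q * (1 - B * ((1 + A) * P * (1 + C) - 1)) := by
  have hAP : (1 + A) * P = 1 + (1 + C) * (A * P) := by
    calc (1 + A) * P = (1 - C * A) * P + (1 + C) * (A * P) := by noncomm_ring
      _ = 1 + (1 + C) * (A * P) := by rw [hP]
  have hQB : Q * (1 + B) = 1 + Q * B * (1 + C) := by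
    calc Q * (1 + B) = Q * (1 - B * C) + Q * B * (1 + C) := by noncomm_ring
      _ = 1 + Q * B * (1 + C) := by rw [hQ]
  have hdiff : A * P - Q * B = Q * (A - B) * P := by
    calc A * P - Q * B = Q * (1 - B * C) * (A * P) - Q * B * ((1 - C * A) * P) := by
          rw [hP, hQ, one_mul, mul_one]
      _ = Q * (A - B) * P := by noncomm_ring
  have key : (1 + A) * P * (1 + C) - (1 + C) * (Q * (1 + B)) =
      (1 + C) * (Q * (A - B) * P) * (1 + C) := by
    rw [hAP, hQB, ← hdiff]; noncomm_ring
  rw [← sub_eq_zero] at key ⊢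
  rw [← key]
  noncomm_ring

theorem resolvent_rearrangement (n : ℕ) (A B C : Matrix (Fin n) (Fin n) ℂ)
    [Invertible (1 - C * A)] [Invertible (1 - B * C)]
    [Invertible (1 - B * ((1 + A) * (1 - C * A)⁻¹ * (1 + C) - 1))]
    [Invertible (1 - ((1 + C) * (1 - B * C)⁻¹ * (1 + B) - 1) * A)] :
    (1 - C * A)⁻¹ * (1 + C) *
        (1 - B * ((1 + A) * (1 - C * A)⁻¹ * (1 + C) - 1))⁻¹ =
      (1 - ((1 + C) * (1 - B * C)⁻¹ * (1 + B) - 1) * A)⁻¹ * (1 + C) *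
        (1 - B * C)⁻¹ := by
  have h := resolvent_intertwining (mul_inv_of_invertible (1 - C * A))
    (inv_mul_of_invertible (1 - B * C))
  rw [mul_inv_eq_iff_eq_mul_of_invertible, mul_assoc _ (1 + C) (1 - B * C)⁻¹, mul_assoc,
    eq_comm, inv_mul_eq_iff_eq_mul_of_invertible]
  exact h.symm
end

section
/- Let G₀, T₁, T₂, T₃ be n×n complex matrices with G₀ symmetric (G₀ᵀ = G₀) and invertible, and set T̃_α := T_αᵀ for α = 1,2,3. Define W₂₁ := G₀⁻¹ * (1 - G₀T₃G₀T₂)⁻¹ * (1 + G₀T₃) * (1 - G₀T₁*((1 + G₀T₂)*(1 - G₀T₃G₀T₂)⁻¹*(1 + G₀T₃) - 1))⁻¹ and W̃₁₂ := G₀⁻¹ * (1 - G₀T̃₃G₀T̃₁)⁻¹ * (1 + G₀T̃₃) * (1 - G₀T̃₂*((1 + G₀T̃₁)*(1 - G₀T̃₃G₀T̃₁)⁻¹*(1 + G₀T̃₃) - 1))⁻¹, assuming all inverted matrices are invertible. Then W̃₁₂ᵀ = W₂₁. -/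
open Matrix

noncomputable def Wop {n : ℕ} (G₀ Ta Tb Tc : Matrix (Fin n) (Fin n) ℂ) :
    Matrix (Fin n) (Fin n) ℂ :=
  G₀⁻¹ * (1 - G₀ * Tc * G₀ * Tb)⁻¹ * (1 + G₀ * Tc) *
    (1 - G₀ * Ta * ((1 + G₀ * Tb) * (1 - G₀ * Tc * G₀ * Tb)⁻¹ * (1 + G₀ * Tc) - 1))⁻¹

theorem scattering_intertwine {R : Type*} [Ring R] {a b c X Y : R}
    (hX : (1 - c * b) * X = 1) (hY : Y * (1 - a * c) = 1) :
    (1 + c) * Y * (1 - a * ((1 + b) * X * (1 + c) - 1)) =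
      (1 - ((1 + c) * Y * (1 + a) - 1) * b) * X * (1 + c) := by
  have hbX : (1 + b) * X * (1 + c) = (1 + c) + (1 + c) * b * X * (1 + c) := by
    calc (1 + b) * X * (1 + c) = ((1 - c * b) * X) * (1 + c) + (1 + c) * b * X * (1 + c) := by
          noncomm_ring
      _ = _ := by rw [hX, one_mul]
  have hYa : (1 + c) * Y * (1 + a) = (1 + c) + (1 + c) * Y * a * (1 + c) := by
    calc (1 + c) * Y * (1 + a) = (1 + c) * (Y * (1 - a * c)) + (1 + c) * Y * a * (1 + c) := by
          noncomm_ring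
      _ = _ := by rw [hY, mul_one]
  have hab : Y * a - b * X + Y * (b - a) * X = 0 := by
    calc Y * a - b * X + Y * (b - a) * X
        = Y * a * 1 - 1 * b * X + Y * (b - a) * X := by rw [mul_one, one_mul]
      _ = Y * a * ((1 - c * b) * X) - (Y * (1 - a * c)) * b * X + Y * (b - a) * X := by
          rw [hX, hY]
      _ = 0 := by noncomm_ring
  rw [← sub_eq_zero]
  calc _ = (1 + c) * Y * (1 + a) - (1 + b) * X * (1 + c)
        + (1 + c) * (Y * (b - a) * X) * (1 + c) := by noncomm_ring
    _ = (1 + c) * (Y * a - b * X + Y * (b - a) * X) * (1 + c) := by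
        rw [hbX, hYa]; noncomm_ring
    _ = 0 := by rw [hab, mul_zero, zero_mul]

theorem scattering_intertwine_conj {R : Type*} [Ring R] {G H t₁ t₂ t₃ X Y : R}
    (hGH : G * H = 1) (hHG : H * G = 1)
    (hX : (1 - G * t₃ * G * t₂) * X = 1) (hY : Y * (1 - t₁ * G * (t₃ * G)) = 1) :
    (1 + t₃ * G) * Y * H * (1 - G * t₁ * ((1 + G * t₂) * X * (1 + G * t₃) - 1)) =
      (1 - ((1 + t₃ * G) * Y * (1 + t₁ * G) - 1) * (t₂ * G)) * (H * X * (1 + G * t₃)) := by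
  have hXc : (1 - t₃ * G * (t₂ * G)) * (H * X * G) = 1 := by
    calc _ = H * G * (1 - t₃ * G * (t₂ * G)) * (H * X * G) := by rw [hHG, one_mul]
      _ = H * (G * H * X - G * t₃ * G * t₂ * (G * H) * X) * G := by noncomm_ring
      _ = H * ((1 - G * t₃ * G * t₂) * X) * G := by rw [hGH]; noncomm_ring
      _ = 1 := by rw [hX, mul_one, hHG]
  have key := congrArg (· * H) (scattering_intertwine hXc hY)
  have hl : H * (1 - G * t₁ * ((1 + G * t₂) * X * (1 + G * t₃) - 1)) =
      (1 - t₁ * G * ((1 + t₂ * G) * (H * X * G) * (1 + t₃ * G) - 1)) * H := by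
    calc _ = H - H * G * t₁ * ((1 + G * t₂) * X * (1 + G * t₃) - 1) := by noncomm_ring
      _ = H - t₁ * (((G * H) + G * t₂ * (G * H)) * X * (G * H + G * t₃ * (G * H)) - G * H) := by
          simp only [hGH, hHG, one_mul, mul_one]
      _ = _ := by noncomm_ring
  have hr : H * X * (1 + G * t₃) = H * X * G * (1 + t₃ * G) * H := by
    calc _ = H * X * (G * H + G * t₃ * (G * H)) := by simp only [hGH, mul_one]
      _ = _ := by noncomm_ring
  rw [mul_assoc _ H, hl, hr]
  simpa only [mul_assoc] using key

theorem W_transpose (n : ℕ) (G₀ T₁ T₂ T₃ : Matrix (Fin n) (Fin n) ℂ)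
    (hsymm : G₀ᵀ = G₀) [Invertible G₀]
    [Invertible (1 - G₀ * T₃ * G₀ * T₂)]
    [Invertible (1 - G₀ * T₁ *
        ((1 + G₀ * T₂) * (1 - G₀ * T₃ * G₀ * T₂)⁻¹ * (1 + G₀ * T₃) - 1))]
    [Invertible (1 - G₀ * T₃ᵀ * G₀ * T₁ᵀ)]
    [Invertible (1 - G₀ * T₂ᵀ *
        ((1 + G₀ * T₁ᵀ) * (1 - G₀ * T₃ᵀ * G₀ * T₁ᵀ)⁻¹ * (1 + G₀ * T₃ᵀ) - 1))] :
    (Wop G₀ T₂ᵀ T₁ᵀ T₃ᵀ)ᵀ = Wop G₀ T₁ T₂ T₃ := by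
  have hX := Matrix.mul_inv_of_invertible (1 - G₀ * T₃ * G₀ * T₂)
  have hGH := Matrix.mul_inv_of_invertible G₀
  have hHG := Matrix.inv_mul_of_invertible G₀
  have hM := Matrix.mul_inv_of_invertible (1 - G₀ * T₁ *
    ((1 + G₀ * T₂) * (1 - G₀ * T₃ * G₀ * T₂)⁻¹ * (1 + G₀ * T₃) - 1))
  have hY := congrArg transpose
    (Matrix.mul_inv_of_invertible (1 - G₀ * T₃ᵀ * G₀ * T₁ᵀ))
  have hN := congrArg transpose
    (Matrix.mul_inv_of_invertible (1 - G₀ * T₂ᵀ *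
      ((1 + G₀ * T₁ᵀ) * (1 - G₀ * T₃ᵀ * G₀ * T₁ᵀ)⁻¹ * (1 + G₀ * T₃ᵀ) - 1)))
  have hHs : (G₀⁻¹)ᵀ = G₀⁻¹ := by rw [transpose_nonsing_inv, hsymm]
  unfold Wop
  generalize (1 - G₀ * T₂ᵀ * ((1 + G₀ * T₁ᵀ) * (1 - G₀ * T₃ᵀ * G₀ * T₁ᵀ)⁻¹ *
    (1 + G₀ * T₃ᵀ) - 1))⁻¹ = N at hN ⊢
  generalize (1 - G₀ * T₃ᵀ * G₀ * T₁ᵀ)⁻¹ = Y at hN hY ⊢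
  simp only [transpose_mul, transpose_sub, transpose_add, transpose_one, transpose_transpose,
    hsymm, hHs] at hN hY ⊢
  have key := scattering_intertwine_conj hGH hHG hX
    (t₁ := T₁) (Y := Yᵀ) (by simpa only [mul_assoc] using hY)
  generalize (1 - G₀ * T₁ *
    ((1 + G₀ * T₂) * (1 - G₀ * T₃ * G₀ * T₂)⁻¹ * (1 + G₀ * T₃) - 1)) = M at hM key ⊢
  simp only [← mul_assoc] at hN key ⊢
  calc _ = Nᵀ * ((1 + T₃ * G₀) * Yᵀ * G₀⁻¹ * M) * M⁻¹ := by
        simp only [mul_assoc, hM, mul_one]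
    _ = _ := by
        rw [key]
        simp only [← mul_assoc, hN, one_mul]
end

section
/- Let G₀, T₁, T₂, T₃ be n×n complex matrices with G₀ symmetric (G₀ᵀ = G₀) and invertible, and set T̃_α := T_αᵀ. Define Im(M) := (M - M†)/(2i), R(T) := G₀ * ((T - T†)/(2i) - T * Im(G₀) * T†) * G₀†, Q(T) := G₀† * ((T - T†)/(2i) - T† * Im(G₀) * T) * G₀, W₂₁ := G₀⁻¹ * (1 - G₀T₃G₀T₂)⁻¹ * (1 + G₀T₃) * (1 - G₀T₁*((1 + G₀T₂)*(1 - G₀T₃G₀T₂)⁻¹*(1 + G₀T₃) - 1))⁻¹, and W̃₁₂ := G₀⁻¹ * (1 - G₀T̃₃G₀T̃₁)⁻¹ * (1 + G₀T̃₃) * (1 - G₀T̃₂*((1 + G₀T̃₁)*(1 - G₀T̃₃G₀T̃₁)⁻¹*(1 + G₀T̃₃) - 1))⁻¹, assuming all inverted matrices are invertible. Then Tr[Q(T̃₁) * W̃₁₂ * R(T̃₂) * W̃₁₂†] = Tr[Q(T₂) * W₂₁ * R(T₁) * W₂₁†]. -/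
open Matrix

noncomputable def matIm {n : ℕ} (M : Matrix (Fin n) (Fin n) ℂ) :
    Matrix (Fin n) (Fin n) ℂ :=
  (2 * Complex.I)⁻¹ • (M - Mᴴ)

noncomputable def Rop {n : ℕ} (G₀ T : Matrix (Fin n) (Fin n) ℂ) :
    Matrix (Fin n) (Fin n) ℂ :=
  G₀ * ((2 * Complex.I)⁻¹ • (T - Tᴴ) - T * matIm G₀ * Tᴴ) * G₀ᴴ

noncomputable def Qop {n : ℕ} (G₀ T : Matrix (Fin n) (Fin n) ℂ) :
    Matrix (Fin n) (Fin n) ℂ :=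
  G₀ᴴ * ((2 * Complex.I)⁻¹ • (T - Tᴴ) - Tᴴ * matIm G₀ * T) * G₀

/-- The multiple-scattering exchange identity: if `P = 1 + z + z y P` and `P' = 1 + z + P' x z`,
then `P` intertwines `1 - x S` with `1 - S' y`, where `S = (1 + y) P - 1` and
`S' = P' (1 + x) - 1`. -/
lemma scattering_exchange {R : Type*} [Ring R] {x y z P P' : R}
    (hP : P = 1 + z + z * y * P) (hP' : P' = 1 + z + P' * x * z) :
    (1 - (P' * (1 + x) - 1) * y) * P = P' * (1 - x * ((1 + y) * P - 1)) := by
  have h₁ : P' * P = P' * (1 + z + z * y * P) := by rw [← hP]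
  have h₂ : P' * P = (1 + z + P' * x * z) * P := by rw [← hP']
  have h₃ : P' * x * P = P' * x * (1 + z + z * y * P) := by rw [← hP]
  have h₄ : P' * (y * P) = (1 + z + P' * x * z) * (y * P) := by rw [← hP']
  rw [← sub_eq_zero]
  have e : (1 - (P' * (1 + x) - 1) * y) * P - P' * (1 - x * ((1 + y) * P - 1)) =
      (P - (1 + z + z * y * P)) - (P' - (1 + z + P' * x * z))
      + (P' * x * P - P' * x * (1 + z + z * y * P))
      - (P' * (y * P) - (1 + z + P' * x * z) * (y * P)) := by
    noncomm_ring
  rw [e, sub_eq_zero.2 hP, sub_eq_zero.2 hP', sub_eq_zero.2 h₃, sub_eq_zero.2 h₄]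
  simp

section

variable {n : ℕ} {G₀ : Matrix (Fin n) (Fin n) ℂ}

lemma transpose_conjTranspose_comm (M : Matrix (Fin n) (Fin n) ℂ) : Mᴴᵀ = Mᵀᴴ := rfl

lemma transpose_matIm (M : Matrix (Fin n) (Fin n) ℂ) : (matIm M)ᵀ = matIm Mᵀ := by
  simp only [matIm, transpose_smul, transpose_sub, transpose_conjTranspose_comm]

lemma transpose_Rop (hsymm : G₀ᵀ = G₀) (T : Matrix (Fin n) (Fin n) ℂ) :
    (Rop G₀ T)ᵀ = Qop G₀ Tᵀ := by
  simp only [Rop, Qop, transpose_mul, transpose_smul, transpose_sub, transpose_matIm,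
    transpose_conjTranspose_comm, hsymm, Matrix.mul_assoc]

lemma transpose_Qop (hsymm : G₀ᵀ = G₀) (T : Matrix (Fin n) (Fin n) ℂ) :
    (Qop G₀ T)ᵀ = Rop G₀ Tᵀ := by
  rw [← transpose_transpose T, ← transpose_Rop hsymm, transpose_transpose, transpose_transpose]

/-- The multiple-scattering operator of the complementary system is the transpose of the original
one. -/
lemma transpose_Wop (hsymm : G₀ᵀ = G₀) {T₁ T₂ T₃ : Matrix (Fin n) (Fin n) ℂ}
    (hG : IsUnit G₀.det)
    (hP : IsUnit (1 - G₀ * T₃ * G₀ * T₂).det)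
    (hW : IsUnit (1 - G₀ * T₁ *
        ((1 + G₀ * T₂) * (1 - G₀ * T₃ * G₀ * T₂)⁻¹ * (1 + G₀ * T₃) - 1)).det)
    (hP' : IsUnit (1 - G₀ * T₃ᵀ * G₀ * T₁ᵀ).det)
    (hW' : IsUnit (1 - G₀ * T₂ᵀ *
        ((1 + G₀ * T₁ᵀ) * (1 - G₀ * T₃ᵀ * G₀ * T₁ᵀ)⁻¹ * (1 + G₀ * T₃ᵀ) - 1)).det) :
    (Wop G₀ T₂ᵀ T₁ᵀ T₃ᵀ)ᵀ = Wop G₀ T₁ T₂ T₃ := by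
  set A := 1 - G₀ * T₃ * G₀ * T₂ with hA
  set A' := 1 - G₀ * T₃ᵀ * G₀ * T₁ᵀ with hA'
  set P := A⁻¹ * (1 + G₀ * T₃) with hPdef
  set P₁ := A'⁻¹ * (1 + G₀ * T₃ᵀ) with hP₁def
  set P' := G₀ * P₁ᵀ * G₀⁻¹ with hP'def
  have hAP : A * P = 1 + G₀ * T₃ := mul_nonsing_inv_cancel_left _ _ hP
  have hAP₁ : A' * P₁ = 1 + G₀ * T₃ᵀ := mul_nonsing_inv_cancel_left _ _ hP'
  have hGG : G₀⁻¹ * G₀ = 1 := nonsing_inv_mul _ hG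
  have hGG' : G₀ * G₀⁻¹ = 1 := mul_nonsing_inv _ hG
  have hGt : (G₀⁻¹)ᵀ = G₀⁻¹ := by rw [transpose_nonsing_inv, hsymm]
  have hGc (X : Matrix (Fin n) (Fin n) ℂ) : G₀⁻¹ * (G₀ * X) = X :=
    nonsing_inv_mul_cancel_left _ _ hG
  have eP : P = 1 + G₀ * T₃ + G₀ * T₃ * (G₀ * T₂) * P := by
    rw [← hAP, hA]; noncomm_ring
  have eP' : P' = 1 + G₀ * T₃ + P' * (G₀ * T₁) * (G₀ * T₃) := by
    have h : P₁ = 1 + G₀ * T₃ᵀ + G₀ * T₃ᵀ * (G₀ * T₁ᵀ) * P₁ := by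
      rw [← hAP₁, hA']; noncomm_ring
    have h' := congrArg (fun X => G₀ * Xᵀ * G₀⁻¹) h
    simpa [transpose_mul, hsymm, hP'def, Matrix.mul_assoc, Matrix.mul_add, Matrix.add_mul, hGc,
      hGG, hGG'] using h'
  have key := scattering_exchange eP eP'
  set B := 1 - G₀ * T₁ * ((1 + G₀ * T₂) * P - 1) with hB
  set B₁ := 1 - G₀ * T₂ᵀ * ((1 + G₀ * T₁ᵀ) * P₁ - 1) with hB₁
  have hBu : IsUnit B.det := by rwa [Matrix.mul_assoc (1 + G₀ * T₂)] at hW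
  have hB₁u : IsUnit B₁ᵀ.det := by
    rw [det_transpose]; rwa [Matrix.mul_assoc (1 + G₀ * T₁ᵀ)] at hW'
  have hconj : 1 - (P' * (1 + G₀ * T₁) - 1) * (G₀ * T₂) = G₀ * B₁ᵀ * G₀⁻¹ := by
    simp [hB₁, hP'def, transpose_mul, hsymm, Matrix.mul_assoc, Matrix.mul_add, Matrix.add_mul,
      Matrix.mul_sub, Matrix.sub_mul, hGc, hGG']
  have e₁ : Wop G₀ T₁ T₂ T₃ = G₀⁻¹ * P * B⁻¹ := by
    simp only [Wop, hPdef, hB, hA, Matrix.mul_assoc]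
  have e₂ : Wop G₀ T₂ᵀ T₁ᵀ T₃ᵀ = G₀⁻¹ * P₁ * B₁⁻¹ := by
    simp only [Wop, hP₁def, hB₁, hA', Matrix.mul_assoc]
  rw [hconj] at key
  have key' : B₁ᵀ * (G₀⁻¹ * P) = P₁ᵀ * G₀⁻¹ * B := by
    have := congrArg (G₀⁻¹ * ·) key
    simpa only [hP'def, Matrix.mul_assoc, hGc] using this
  rw [e₁, e₂, transpose_mul, transpose_mul, hGt, transpose_nonsing_inv]
  calc (B₁ᵀ)⁻¹ * (P₁ᵀ * G₀⁻¹) = (B₁ᵀ)⁻¹ * (P₁ᵀ * G₀⁻¹ * B) * B⁻¹ := by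
        rw [Matrix.mul_assoc (B₁ᵀ)⁻¹, mul_nonsing_inv_cancel_right _ _ hBu]
    _ = G₀⁻¹ * P * B⁻¹ := by rw [← key', nonsing_inv_mul_cancel_left _ _ hB₁u]

end

theorem generalized_reciprocity (n : ℕ) (G₀ T₁ T₂ T₃ : Matrix (Fin n) (Fin n) ℂ)
    (hsymm : G₀ᵀ = G₀) [Invertible G₀]
    [Invertible (1 - G₀ * T₃ * G₀ * T₂)]
    [Invertible (1 - G₀ * T₁ *
        ((1 + G₀ * T₂) * (1 - G₀ * T₃ * G₀ * T₂)⁻¹ * (1 + G₀ * T₃) - 1))]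
    [Invertible (1 - G₀ * T₃ᵀ * G₀ * T₁ᵀ)]
    [Invertible (1 - G₀ * T₂ᵀ *
        ((1 + G₀ * T₁ᵀ) * (1 - G₀ * T₃ᵀ * G₀ * T₁ᵀ)⁻¹ * (1 + G₀ * T₃ᵀ) - 1))] :
    Matrix.trace (Qop G₀ T₁ᵀ * Wop G₀ T₂ᵀ T₁ᵀ T₃ᵀ * Rop G₀ T₂ᵀ *
        (Wop G₀ T₂ᵀ T₁ᵀ T₃ᵀ)ᴴ) =
      Matrix.trace (Qop G₀ T₂ * Wop G₀ T₁ T₂ T₃ * Rop G₀ T₁ *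
        (Wop G₀ T₁ T₂ T₃)ᴴ) := by
  have hW := transpose_Wop hsymm (isUnit_det_of_invertible G₀)
    (isUnit_det_of_invertible (1 - G₀ * T₃ * G₀ * T₂)) (isUnit_det_of_invertible _)
    (isUnit_det_of_invertible (1 - G₀ * T₃ᵀ * G₀ * T₁ᵀ)) (isUnit_det_of_invertible _)
  rw [← trace_transpose, transpose_mul, transpose_mul, transpose_mul, transpose_Rop hsymm,
    transpose_Qop hsymm, transpose_conjTranspose_comm, hW, transpose_transpose,
    transpose_transpose, trace_mul_comm]
  simp only [Matrix.mul_assoc]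
end
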